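/- There exist absolute constants C, c > 0 such that for every sufficiently large prime p, every set A ⊆ (ZMod p) \ {0} with |A| = α·p and α ≥ C·(log log p)^{2/3}/(log p)^{1/3}, and every ε satisfying C·α·(log log p)^{4/3}/(log p)^{2/3} ≤ ε ≤ c·α³, one has |A +_ε A*| ≥ min(2·√(|A|·p), p) − C·(ε/α)^{1/4}·p, where A* := {a⁻¹ : a ∈ A}. -/

import Mathlib

open Finset
open scoped Classical Pointwise

noncomputable section

/-- Set of multiplicative inverses. -/
def inv' {p : ℕ} (A : Finset (ZMod p)) : Finset (ZMod p) := A.image (fun x => x⁻¹)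

/-- Partial sumset `A +_ε B`. -/
def psum {p : ℕ} [NeZero p] (A B : Finset (ZMod p)) (ε : ℝ) : Finset (ZMod p) :=
  Finset.univ.filter fun x =>
    ε * p ≤ (((A ×ˢ B).filter fun ab => ab.1 + ab.2 = x).card : ℝ)

/-- Number of representations `x = a + b`. -/
def rep {p : ℕ} (A B : Finset (ZMod p)) (x : ZMod p) : ℕ :=
  ∑ a ∈ A, ∑ b ∈ B, if a + b = x then 1 else 0

lemma rep_split {p : ℕ} (A B : Finset (ZMod p)) (x : ZMod p) :
    rep A B x = rep (A ∪ B) (A ∩ B) x + rep (A \ B) (B \ A) x := by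
  have h1 : ∀ f : ZMod p → ℕ, ∑ a ∈ A, f a = ∑ a ∈ A ∩ B, f a + ∑ a ∈ A \ B, f a := by
    intro f
    rw [← Finset.sum_union (Finset.disjoint_left.2 (by simp +contextual))]
    congr 1; ext; simp; tauto
  have h2 : ∀ f : ZMod p → ℕ, ∑ a ∈ B, f a = ∑ a ∈ A ∩ B, f a + ∑ a ∈ B \ A, f a := by
    intro f
    rw [← Finset.sum_union (Finset.disjoint_left.2 (by simp +contextual))]
    congr 1; ext; simp; tauto
  have h3 : ∀ f : ZMod p → ℕ, ∑ a ∈ A ∪ B, f a = ∑ a ∈ A ∩ B, f a + ∑ a ∈ A \ B, f a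
      + ∑ a ∈ B \ A, f a := by
    intro f
    rw [← h1 f, ← Finset.sum_union (Finset.disjoint_left.2 (by simp +contextual))]
    congr 1; ext; simp
  have h4 : ∑ a ∈ A ∩ B, ∑ b ∈ B \ A, (if a + b = x then 1 else 0)
      = ∑ a ∈ B \ A, ∑ b ∈ A ∩ B, (if a + b = x then 1 else 0) := by
    rw [Finset.sum_comm]
    simp_rw [add_comm]
  unfold rep
  rw [h1, h3]
  simp_rw [h2, Finset.sum_add_distrib]
  rw [h4]; ring

lemma rep_shift {p : ℕ} (A B : Finset (ZMod p)) (e x : ZMod p) :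
    rep A (B.image (fun b => b + e)) x = rep A B (x - e) := by
  unfold rep
  refine Finset.sum_congr rfl fun a _ => ?_
  rw [Finset.sum_image (by intro a _ b _ h; simpa using h)]
  refine Finset.sum_congr rfl fun b _ => ?_
  congr 1
  rw [eq_sub_iff_add_eq, add_assoc]

lemma rep_le_right {p : ℕ} (A B : Finset (ZMod p)) (x : ZMod p) : rep A B x ≤ B.card := by
  unfold rep
  rw [Finset.sum_comm, Finset.card_eq_sum_ones]
  refine Finset.sum_le_sum fun b _ => ?_
  have : ∀ a ∈ A, (if a + b = x then 1 else 0) = if a = x - b then 1 else 0 := by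
    intro a _; simp [eq_sub_iff_add_eq]
  rw [Finset.sum_congr rfl this, Finset.sum_ite_eq']
  split_ifs <;> simp

lemma rep_comm {p : ℕ} (A B : Finset (ZMod p)) (x : ZMod p) : rep A B x = rep B A x := by
  unfold rep
  rw [Finset.sum_comm]
  simp_rw [add_comm]

lemma rep_le_left {p : ℕ} (A B : Finset (ZMod p)) (x : ZMod p) : rep A B x ≤ A.card := by
  rw [rep_comm]; exact rep_le_right _ _ _

lemma sum_rep {p : ℕ} [NeZero p] (A B : Finset (ZMod p)) :
    ∑ x, rep A B x = A.card * B.card := by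
  unfold rep
  rw [Finset.sum_comm]
  simp_rw [Finset.sum_comm (s := Finset.univ)]
  simp

lemma rep_mono_right {p : ℕ} (A : Finset (ZMod p)) {B B' : Finset (ZMod p)} (h : B' ⊆ B)
    (x : ZMod p) : rep A B' x ≤ rep A B x := by
  unfold rep
  exact Finset.sum_le_sum fun a _ => Finset.sum_le_sum_of_subset h

lemma exists_shift {p : ℕ} [Fact p.Prime] (A B : Finset (ZMod p)) (hA : A.Nonempty)
    (hA' : A.card < p) (hB : 2 ≤ B.card) :
    ∃ e : ZMod p, (A ∩ B.image (fun b => b + e)).Nonempty ∧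
      (A ∩ B.image (fun b => b + e)).card < B.card := by
  by_contra! H
  obtain ⟨b₁, hb₁, b₂, hb₂, hne⟩ := Finset.one_lt_card.1 hB
  have key : ∀ a ∈ A, a + (b₂ - b₁) ∈ A := by
    intro a ha
    have h1 := H (a - b₁) ⟨a, by simp [ha, hb₁]⟩
    have h2 : (B.image (fun b => b + (a - b₁))).card ≤ B.card := Finset.card_image_le
    have h3 := Finset.eq_of_subset_of_card_le (Finset.inter_subset_right (s₁ := A)) (h2.trans h1)
    have h4 : b₂ + (a - b₁) ∈ A ∩ B.image (fun b => b + (a - b₁)) := by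
      rw [h3]; exact Finset.mem_image_of_mem _ hb₂
    have := (Finset.mem_inter.1 h4).1
    convert this using 1; ring
  obtain ⟨a, ha⟩ := hA
  have key2 : ∀ n : ℕ, a + n * (b₂ - b₁) ∈ A := by
    intro n
    induction n with
    | zero => simpa using ha
    | succ n ih =>
      have := key _ ih
      convert this using 1; push_cast; ring
  have hu : A = Finset.univ := by
    ext x
    simp only [Finset.mem_univ, iff_true]
    have hd : b₂ - b₁ ≠ 0 := sub_ne_zero.2 (Ne.symm hne)
    have := key2 ((x - a) / (b₂ - b₁)).val
    rw [ZMod.natCast_zmod_val, div_mul_cancel₀ _ hd] at this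
    simpa using this
  rw [hu, Finset.card_univ, ZMod.card] at hA'
  exact lt_irrefl _ hA'

/-- The theorem of Pollard, in the range where `|A| + |B| ≤ p + t`. -/
lemma pollard_aux {p : ℕ} [Fact p.Prime] : ∀ (n : ℕ) (A B : Finset (ZMod p)) (t : ℕ),
    B.card ≤ n → t ≤ A.card → t ≤ B.card → A.card + B.card ≤ p + t →
    t * (A.card + B.card) ≤ ∑ x, min t (rep A B x) + t * t := by
  intro n
  induction n with
  | zero =>
    intro A B t hn hA hB hs
    have : t = 0 := by omega
    subst this; simp
  | succ n ih =>
    intro A B t hn hA hB hs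
    rcases Nat.eq_zero_or_pos t with rfl | ht
    · simp
    rcases hB.eq_or_lt with hB | hB
    · have : ∑ x, min t (rep A B x) = A.card * B.card := by
        rw [← sum_rep]
        refine Finset.sum_congr rfl fun x _ => min_eq_right ?_
        rw [hB]; exact rep_le_right _ _ _
      rw [this, ← hB]
      apply le_of_eq; ring
    obtain ⟨e, he1, he2⟩ := exists_shift A B (Finset.card_pos.1 (by omega)) (by omega) (by omega)
    set D := B.image (fun b => b + e) with hD
    have hDc : D.card = B.card := Finset.card_image_of_injective _ (add_left_injective e)
    have hsum : ∑ x, min t (rep A B x) = ∑ x, min t (rep A D x) := by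
      simp_rw [hD, rep_shift]
      exact (Fintype.sum_equiv (Equiv.subRight e) _ _ (fun x => rfl)).symm
    rw [hsum, ← hDc]
    rw [← hDc] at he2 hs hB hn
    have hUV := Finset.card_union_add_card_inter A D
    have hu : 0 < (A ∩ D).card := Finset.card_pos.2 he1
    have hA' := Finset.card_sdiff_add_card_inter A D
    have hD' := Finset.card_sdiff_add_card_inter D A
    rw [Finset.inter_comm D A] at hD'
    simp_rw [rep_split A D]
    by_cases htu : t ≤ (A ∩ D).card
    · have h1 := ih (A ∪ D) (A ∩ D) t (by omega) (by omega) htu (by omega)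
      rw [hUV] at h1
      refine h1.trans ?_
      gcongr
      omega
    · push Not at htu
      have h1 := ih (A \ D) (D \ A) (t - (A ∩ D).card) (by omega) (by omega) (by omega) (by omega)
      have h2 : ∑ x, rep (A ∪ D) (A ∩ D) x = (A ∪ D).card * (A ∩ D).card := sum_rep _ _
      have h3 : ∑ x, rep (A ∪ D) (A ∩ D) x + ∑ x, min (t - (A ∩ D).card) (rep (A \ D) (D \ A) x)
          ≤ ∑ x, min t (rep (A ∪ D) (A ∩ D) x + rep (A \ D) (D \ A) x) := by
        rw [← Finset.sum_add_distrib]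
        refine Finset.sum_le_sum fun x _ => ?_
        have := rep_le_right (A ∪ D) (A ∩ D) x
        omega
      generalize (∑ x, min (t - (A ∩ D).card) (rep (A \ D) (D \ A) x)) = X at *
      generalize (∑ x, min t (rep (A ∪ D) (A ∩ D) x + rep (A \ D) (D \ A) x)) = Y at *
      rw [h2] at h3
      obtain ⟨w, hw⟩ : ∃ w, t = (A ∩ D).card + w := ⟨t - (A ∩ D).card, by omega⟩
      generalize (A ∩ D).card = u at *
      generalize (A ∪ D).card = v at *
      generalize (A \ D).card = a' at *
      generalize (D \ A).card = d' at *
      subst hw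
      have : u + w - u = w := by omega
      rw [this] at h1
      have hv : v = a' + d' + u := by omega
      subst hv
      rw [← hA', ← hD']
      nlinarith

lemma pollard {p : ℕ} [Fact p.Prime] (A B : Finset (ZMod p)) (t : ℕ)
    (hA : t ≤ A.card) (hB : t ≤ B.card) :
    t * min p (A.card + B.card - t) ≤ ∑ x, min t (rep A B x) := by
  have hAp : A.card ≤ p := by simpa [ZMod.card] using Finset.card_le_univ A
  by_cases h : A.card + B.card ≤ p + t
  · have := pollard_aux B.card A B t le_rfl hA hB h
    have h2 : t * min p (A.card + B.card - t) + t * t ≤ t * (A.card + B.card) := by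
      rw [← mul_add]; exact Nat.mul_le_mul_left _ (by omega)
    omega
  · obtain ⟨B', hB', hc⟩ := Finset.exists_subset_card_eq (s := B) (n := p + t - A.card) (by omega)
    have := pollard_aux B'.card A B' t le_rfl hA (by omega) (by omega)
    have h2 : t * min p (A.card + B.card - t) + t * t ≤ t * (A.card + B'.card) := by
      rw [← mul_add]; exact Nat.mul_le_mul_left _ (by omega)
    have h3 : ∑ x, min t (rep A B' x) ≤ ∑ x, min t (rep A B x) := by
      refine Finset.sum_le_sum fun x _ => ?_
      have := rep_mono_right A hB' x
      omega
    omega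

/-- Kloosterman sum. -/
def kloo {p : ℕ} [Fact p.Prime] (r s : ZMod p) : ℂ :=
  ∑ x : (ZMod p)ˣ, ZMod.stdAddChar (r * (x : ZMod p) + s * ((x⁻¹ : (ZMod p)ˣ) : ZMod p))

lemma char_sum {p : ℕ} [Fact p.Prime] (b : ZMod p) :
    ∑ r : ZMod p, (ZMod.stdAddChar (r * b) : ℂ) = if b = 0 then (p : ℂ) else 0 := by
  rw [AddChar.sum_mulShift _ (ZMod.isPrimitive_stdAddChar p), ZMod.card]
  split_ifs <;> simp

lemma conj_char {p : ℕ} [Fact p.Prime] (b : ZMod p) :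
    (starRingEnd ℂ) (ZMod.stdAddChar b) = ZMod.stdAddChar (-b) := by
  rw [AddChar.map_neg_eq_conj]

lemma parseval_two {p : ℕ} [Fact p.Prime] {ι : Type} [Fintype ι] (u v : ι → ZMod p) :
    ∑ r : ZMod p, ∑ s : ZMod p, ‖∑ i, (ZMod.stdAddChar (r * u i + s * v i) : ℂ)‖ ^ 2
      = (p : ℝ) ^ 2 * (∑ j, ((Finset.univ.filter fun i => u i = u j ∧ v i = v j).card : ℝ)) := by
  have key : ∀ r s : ZMod p, ((‖∑ i, (ZMod.stdAddChar (r * u i + s * v i) : ℂ)‖ ^ 2 : ℝ) : ℂ)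
      = ∑ j, ∑ i, (ZMod.stdAddChar (r * (u i - u j)) : ℂ) * ZMod.stdAddChar (s * (v i - v j)) := by
    intro r s
    push_cast
    rw [← Complex.mul_conj', map_sum, Finset.sum_mul_sum, Finset.sum_comm]
    refine Finset.sum_congr rfl fun j _ => Finset.sum_congr rfl fun i _ => ?_
    rw [conj_char, ← AddChar.map_add_eq_mul, ← AddChar.map_add_eq_mul]
    congr 1; ring
  apply Complex.ofReal_injective
  push_cast
  push_cast at key
  simp_rw [key]
  have h1 : ∀ r : ZMod p, ∑ s : ZMod p, ∑ j, ∑ i,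
      (ZMod.stdAddChar (r * (u i - u j)) : ℂ) * ZMod.stdAddChar (s * (v i - v j))
      = ∑ j, ∑ i, (ZMod.stdAddChar (r * (u i - u j)) : ℂ) * if v i - v j = 0 then (p : ℂ) else 0 := by
    intro r
    rw [Finset.sum_comm]
    refine Finset.sum_congr rfl fun j _ => ?_
    rw [Finset.sum_comm]
    refine Finset.sum_congr rfl fun i _ => ?_
    rw [← Finset.mul_sum, char_sum]
  simp_rw [h1]
  rw [Finset.sum_comm, Finset.mul_sum]
  refine Finset.sum_congr rfl fun j _ => ?_
  rw [Finset.sum_comm, Finset.card_filter]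
  push_cast
  rw [Finset.mul_sum]
  refine Finset.sum_congr rfl fun i _ => ?_
  rw [← Finset.sum_mul, char_sum]
  simp only [sub_eq_zero]
  by_cases h : u i = u j <;> by_cases h' : v i = v j <;> simp [h, h', sq]

lemma parseval_one {p : ℕ} [Fact p.Prime] (X : Finset (ZMod p)) :
    ∑ r : ZMod p, ‖∑ x ∈ X, (ZMod.stdAddChar (r * x) : ℂ)‖ ^ 2 = (p : ℝ) * X.card := by
  have key : ∀ r : ZMod p, ((‖∑ x ∈ X, (ZMod.stdAddChar (r * x) : ℂ)‖ ^ 2 : ℝ) : ℂ)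
      = ∑ y ∈ X, ∑ x ∈ X, (ZMod.stdAddChar (r * (x - y)) : ℂ) := by
    intro r
    push_cast
    rw [← Complex.mul_conj', map_sum, Finset.sum_mul_sum, Finset.sum_comm]
    refine Finset.sum_congr rfl fun j _ => Finset.sum_congr rfl fun i _ => ?_
    rw [conj_char, ← AddChar.map_add_eq_mul]
    congr 1; ring
  apply Complex.ofReal_injective
  push_cast
  push_cast at key
  simp_rw [key]
  rw [Finset.sum_comm]
  have : ∀ y ∈ X, ∑ r : ZMod p, ∑ x ∈ X, (ZMod.stdAddChar (r * (x - y)) : ℂ) = p := by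
    intro y hy
    rw [Finset.sum_comm]
    simp_rw [char_sum, sub_eq_zero]
    simp [hy]
  rw [Finset.sum_congr rfl this]
  simp [mul_comm]

lemma kloo_sq {p : ℕ} [Fact p.Prime] (r s : ZMod p) :
    kloo r s ^ 2 = ∑ i : (ZMod p)ˣ × (ZMod p)ˣ, ZMod.stdAddChar
      (r * ((i.1 : ZMod p) + (i.2 : ZMod p)) + s * (((i.1⁻¹ : (ZMod p)ˣ) : ZMod p) + ((i.2⁻¹ : (ZMod p)ˣ) : ZMod p))) := by
  rw [sq, kloo, Finset.sum_mul_sum, Fintype.sum_prod_type]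
  refine Finset.sum_congr rfl fun j _ => Finset.sum_congr rfl fun i _ => ?_
  rw [← AddChar.map_add_eq_mul]
  congr 1; ring

lemma card_units_zmod {p : ℕ} [Fact p.Prime] : Fintype.card (ZMod p)ˣ = p - 1 := ZMod.card_units p

lemma kloo_count {p : ℕ} [Fact p.Prime] (j : (ZMod p)ˣ × (ZMod p)ˣ) :
    (Finset.univ.filter fun i : (ZMod p)ˣ × (ZMod p)ˣ =>
      ((i.1 : ZMod p) + (i.2 : ZMod p)) = ((j.1 : ZMod p) + (j.2 : ZMod p)) ∧
      (((i.1⁻¹ : (ZMod p)ˣ) : ZMod p) + ((i.2⁻¹ : (ZMod p)ˣ) : ZMod p)) =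
        (((j.1⁻¹ : (ZMod p)ˣ) : ZMod p) + ((j.2⁻¹ : (ZMod p)ˣ) : ZMod p))).card
      ≤ 2 + if j.2 = - j.1 then p - 1 else 0 := by
  obtain ⟨c, d⟩ := j
  split_ifs with h
  · simp only at h
    subst h
    refine le_trans (Finset.card_le_card (t := Finset.univ.image fun x : (ZMod p)ˣ => (x, -x)) ?_) ?_
    · rintro ⟨a, b⟩ hab
      simp only [Finset.mem_filter, Finset.mem_univ, true_and, Units.val_neg, add_neg_cancel] at hab
      simp only [Finset.mem_image, Finset.mem_univ, true_and]
      refine ⟨a, Prod.ext rfl ?_⟩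
      ext
      rw [Units.val_neg]
      linear_combination -hab.1
    · refine Finset.card_image_le.trans ?_
      rw [Finset.card_univ, ZMod.card_units]
      omega
  · refine le_trans (Finset.card_le_card (t := {(c, d), (d, c)}) ?_) Finset.card_le_two
    rintro ⟨a, b⟩ hab
    simp only [Finset.mem_filter, Finset.mem_univ, true_and, Units.val_inv_eq_inv_val] at hab
    obtain ⟨h1, h2⟩ := hab
    have hs : (c : ZMod p) + d ≠ 0 := by
      intro h0
      apply h
      ext
      rw [Units.val_neg]
      linear_combination h0
    have ha := a.ne_zero
    have hb := b.ne_zero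
    have hc := c.ne_zero
    have hd := d.ne_zero
    rw [inv_add_inv ha hb, inv_add_inv hc hd, h1, div_eq_div_iff (mul_ne_zero ha hb) (mul_ne_zero hc hd)] at h2
    have h3 := mul_left_cancel₀ hs h2
    have h4 : ((a : ZMod p) - c) * (a - d) = 0 := by
      linear_combination a * h1 + h3
    simp only [Finset.mem_insert, Finset.mem_singleton, Prod.mk.injEq]
    rcases mul_eq_zero.1 h4 with h5 | h5
    · left
      refine ⟨Units.ext (by linear_combination h5), Units.ext (by linear_combination h1 - h5)⟩
    · right
      refine ⟨Units.ext (by linear_combination h5), Units.ext (by linear_combination h1 - h5)⟩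

lemma kloo_fourth {p : ℕ} [Fact p.Prime] :
    ∑ r : ZMod p, ∑ s : ZMod p, ‖kloo r s‖ ^ 4 ≤ (p : ℝ) ^ 2 * (3 * ((p : ℝ) - 1) ^ 2) := by
  have h := parseval_two (p := p) (ι := (ZMod p)ˣ × (ZMod p)ˣ) (fun i => (i.1 : ZMod p) + (i.2 : ZMod p))
    (fun i => ((i.1⁻¹ : (ZMod p)ˣ) : ZMod p) + ((i.2⁻¹ : (ZMod p)ˣ) : ZMod p))
  have h' : ∀ r s : ZMod p, ‖kloo r s‖ ^ 4 = ‖kloo r s ^ 2‖ ^ 2 := by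
    intro r s; rw [norm_pow]; ring
  simp_rw [h', kloo_sq]
  rw [h]
  have hp : 1 ≤ p := (Fact.out : p.Prime).one_lt.le
  gcongr
  calc _ ≤ ∑ j : (ZMod p)ˣ × (ZMod p)ˣ, (((2 + if j.2 = - j.1 then p - 1 else 0 : ℕ)) : ℝ) := by
        refine Finset.sum_le_sum fun j _ => ?_
        exact_mod_cast kloo_count j
    _ = _ := by
        rw [Fintype.sum_prod_type]
        push_cast
        simp only [Finset.sum_add_distrib, Finset.sum_ite_eq', Finset.mem_univ, if_true,
          Finset.sum_const, Finset.card_univ, ZMod.card_units, nsmul_eq_mul]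
        push_cast [Nat.cast_sub hp]
        ring

lemma kloo_symm {p : ℕ} [Fact p.Prime] (r s : ZMod p) : kloo r s = kloo s r := by
  unfold kloo
  refine Fintype.sum_equiv (Equiv.inv _) _ _ fun x => ?_
  simp only [Equiv.inv_apply, inv_inv]
  rw [add_comm]

lemma kloo_scale {p : ℕ} [Fact p.Prime] (r s : ZMod p) (u : (ZMod p)ˣ) :
    kloo (r * (u : ZMod p)) (s * ((u⁻¹ : (ZMod p)ˣ) : ZMod p)) = kloo r s := by
  unfold kloo
  refine Fintype.sum_equiv (Equiv.mulLeft u) _ _ fun x => ?_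
  simp only [Equiv.coe_mulLeft, mul_inv, Units.val_mul]
  congr 1; ring

lemma kloo_bound_aux {p : ℕ} [Fact p.Prime] (r s : ZMod p) (hr : r ≠ 0) :
    ‖kloo r s‖ ^ 4 ≤ 3 * (p : ℝ) ^ 3 := by
  have h1 : ∑ u : (ZMod p)ˣ, ‖kloo (r * (u : ZMod p)) (s * ((u⁻¹ : (ZMod p)ˣ) : ZMod p))‖ ^ 4
      ≤ ∑ r : ZMod p, ∑ s : ZMod p, ‖kloo r s‖ ^ 4 := by
    rw [← Fintype.sum_prod_type' (f := fun r s : ZMod p => ‖kloo r s‖ ^ 4)]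
    have hinj : Function.Injective
        (fun u : (ZMod p)ˣ => (r * (u : ZMod p), s * ((u⁻¹ : (ZMod p)ˣ) : ZMod p))) := by
      intro u v h
      simp only [Prod.mk.injEq] at h
      exact Units.ext (mul_left_cancel₀ hr h.1)
    rw [← Finset.sum_image (f := fun q : ZMod p × ZMod p => ‖kloo q.1 q.2‖ ^ 4)
      (s := Finset.univ) (hinj.injOn)]
    exact Finset.sum_le_sum_of_subset_of_nonneg (Finset.subset_univ _) (fun _ _ _ => by positivity)
  simp_rw [kloo_scale] at h1
  rw [Finset.sum_const, Finset.card_univ, ZMod.card_units, nsmul_eq_mul] at h1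
  have hp : 1 < p := (Fact.out : p.Prime).one_lt
  have h2 := h1.trans kloo_fourth
  have hp' : (1 : ℝ) < p := by exact_mod_cast hp
  rw [Nat.cast_sub hp.le, Nat.cast_one] at h2
  have h3 : ((p : ℝ) - 1) * ‖kloo r s‖ ^ 4 ≤ ((p : ℝ) - 1) * (3 * p ^ 2 * (p - 1)) := by
    refine h2.trans (le_of_eq ?_); ring
  have h4 := le_of_mul_le_mul_left h3 (by linarith)
  nlinarith [sq_nonneg (p : ℝ)]

lemma kloo_bound {p : ℕ} [Fact p.Prime] (r s : ZMod p) (h : ¬ (r = 0 ∧ s = 0)) :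
    ‖kloo r s‖ ≤ 2 * (p : ℝ) ^ ((3 : ℝ) / 4) := by
  have h4 : ‖kloo r s‖ ^ 4 ≤ 3 * (p : ℝ) ^ 3 := by
    by_cases hr : r = 0
    · rw [kloo_symm]; exact kloo_bound_aux _ _ (fun hs => h ⟨hr, hs⟩)
    · exact kloo_bound_aux _ _ hr
  refine le_of_pow_le_pow_left₀ (n := 4) (by norm_num) (by positivity) (h4.trans ?_)
  rw [mul_pow, ← Real.rpow_natCast ((p : ℝ) ^ ((3 : ℝ) / 4)), ← Real.rpow_mul (by positivity)]
  norm_num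
  have : (0 : ℝ) ≤ (p : ℝ) ^ 3 := by positivity
  linarith

lemma kloo_trivial {p : ℕ} [Fact p.Prime] (r s : ZMod p) : ‖kloo r s‖ ≤ p := by
  unfold kloo
  refine (norm_sum_le _ _).trans ?_
  simp only [AddChar.norm_apply, Finset.sum_const, Finset.card_univ, ZMod.card_units, nsmul_eq_mul,
    mul_one]
  exact_mod_cast Nat.sub_le p 1

/-- Fourier coefficient of a set. -/
def hatS {p : ℕ} [Fact p.Prime] (X : Finset (ZMod p)) (r : ZMod p) : ℂ :=
  ∑ x ∈ X, (ZMod.stdAddChar (r * x) : ℂ)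

lemma rep_fourier {p : ℕ} [Fact p.Prime] (F T : Finset (ZMod p)) (x : ZMod p) :
    (p : ℂ) * rep F T x = ∑ r, hatS F r * hatS T r * ZMod.stdAddChar (-r * x) := by
  have h : ∀ r : ZMod p, hatS F r * hatS T r * ZMod.stdAddChar (-r * x)
      = ∑ a ∈ F, ∑ b ∈ T, ZMod.stdAddChar (r * (a + b - x)) := by
    intro r
    unfold hatS
    rw [Finset.sum_mul_sum, Finset.sum_mul]
    refine Finset.sum_congr rfl fun a _ => ?_
    rw [Finset.sum_mul]
    refine Finset.sum_congr rfl fun b _ => ?_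
    rw [← AddChar.map_add_eq_mul, ← AddChar.map_add_eq_mul]
    congr 1; ring
  simp_rw [h]
  rw [Finset.sum_comm, rep]
  push_cast
  rw [Finset.mul_sum]
  refine Finset.sum_congr rfl fun a _ => ?_
  rw [Finset.sum_comm, Finset.mul_sum]
  refine Finset.sum_congr rfl fun b _ => ?_
  rw [char_sum]
  simp [sub_eq_zero]

lemma sum_hat_le {p : ℕ} [Fact p.Prime] (F T : Finset (ZMod p)) :
    ∑ r, ‖hatS F r‖ * ‖hatS T r‖ ≤ p * Real.sqrt (F.card * T.card) := by
  have h := Finset.sum_mul_sq_le_sq_mul_sq Finset.univ (fun r => ‖hatS F r‖) (fun r => ‖hatS T r‖)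
  have h1 : ∑ r, ‖hatS F r‖ ^ 2 = (p : ℝ) * F.card := parseval_one F
  have h2 : ∑ r, ‖hatS T r‖ ^ 2 = (p : ℝ) * T.card := parseval_one T
  rw [h1, h2] at h
  refine (Real.le_sqrt_of_sq_le h).trans (le_of_eq ?_)
  rw [show (p : ℝ) * F.card * (p * T.card) = p ^ 2 * (F.card * T.card) by ring,
    Real.sqrt_mul (by positivity), Real.sqrt_sq (by positivity)]

lemma hat_zero {p : ℕ} [Fact p.Prime] (F : Finset (ZMod p)) : hatS F 0 = F.card := by
  simp [hatS]

/-- Equidistribution along the hyperbola. -/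
lemma incidence {p : ℕ} [Fact p.Prime] (F T G S : Finset (ZMod p)) :
    (∑ x : (ZMod p)ˣ, (rep F T x : ℝ) * rep G S ((x⁻¹ : (ZMod p)ˣ) : ZMod p)) ≤
      (F.card * T.card * (G.card * S.card)) / p + 2 * (p : ℝ) ^ ((3 : ℝ) / 4) *
        (Real.sqrt (F.card * T.card) * Real.sqrt (G.card * S.card)) := by
  have hp : (0 : ℝ) < p := by exact_mod_cast (Fact.out : p.Prime).pos
  have hK : ∀ r s : ZMod p, ‖kloo (-r) (-s)‖ ≤ 2 * (p : ℝ) ^ ((3 : ℝ) / 4)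
      + if r = 0 then (if s = 0 then (p : ℝ) else 0) else 0 := by
    intro r s
    have h0 : (0 : ℝ) ≤ 2 * (p : ℝ) ^ ((3 : ℝ) / 4) := by positivity
    by_cases hr : r = 0
    · by_cases hs : s = 0
      · refine (kloo_trivial (-r) (-s)).trans ?_
        rw [if_pos hr, if_pos hs]
        linarith
      · simp only [hr, hs, if_true, if_false, add_zero]
        exact kloo_bound _ _ (by simp [hs])
    · simp only [hr, if_false, add_zero]
      exact kloo_bound _ _ (by simp [hr])
  have h1 : (((p : ℝ) ^ 2 * ∑ x : (ZMod p)ˣ, (rep F T x : ℝ) * rep G S ((x⁻¹ : (ZMod p)ˣ) : ZMod p) : ℝ) : ℂ)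
      = ∑ r, ∑ s, hatS F r * hatS T r * (hatS G s * hatS S s) * kloo (-r) (-s) := by
    simp only [Complex.ofReal_mul, Complex.ofReal_sum, Complex.ofReal_pow, Complex.ofReal_natCast]
    rw [Finset.mul_sum]
    have : ∀ x : (ZMod p)ˣ, (p : ℂ) ^ 2 * ((rep F T x : ℂ) * rep G S ((x⁻¹ : (ZMod p)ˣ) : ZMod p))
        = ∑ r, ∑ s, hatS F r * hatS T r * (hatS G s * hatS S s) *
          ZMod.stdAddChar (-r * (x : ZMod p) + -s * ((x⁻¹ : (ZMod p)ˣ) : ZMod p)) := by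
      intro x
      rw [show (p : ℂ) ^ 2 * ((rep F T x : ℂ) * rep G S ((x⁻¹ : (ZMod p)ˣ) : ZMod p))
        = (p * rep F T x) * (p * rep G S ((x⁻¹ : (ZMod p)ˣ) : ZMod p)) by ring, rep_fourier, rep_fourier,
        Finset.sum_mul_sum]
      refine Finset.sum_congr rfl fun r _ => Finset.sum_congr rfl fun s _ => ?_
      rw [AddChar.map_add_eq_mul]; ring
    simp_rw [this]
    rw [Finset.sum_comm]
    refine Finset.sum_congr rfl fun r _ => ?_
    rw [Finset.sum_comm]
    refine Finset.sum_congr rfl fun s _ => ?_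
    rw [← Finset.mul_sum]
    rfl
  have h2 : (p : ℝ) ^ 2 * ∑ x : (ZMod p)ˣ, (rep F T x : ℝ) * rep G S ((x⁻¹ : (ZMod p)ˣ) : ZMod p)
      ≤ ∑ r, ∑ s, ‖hatS F r‖ * ‖hatS T r‖ * (‖hatS G s‖ * ‖hatS S s‖) *
        (2 * (p : ℝ) ^ ((3 : ℝ) / 4) + if r = 0 then (if s = 0 then (p : ℝ) else 0) else 0) := by
    refine (le_abs_self _).trans ?_
    rw [← Real.norm_eq_abs, ← Complex.norm_real, h1]
    refine (norm_sum_le _ _).trans (Finset.sum_le_sum fun r _ => ?_)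
    refine (norm_sum_le _ _).trans (Finset.sum_le_sum fun s _ => ?_)
    simp only [norm_mul]
    exact mul_le_mul_of_nonneg_left (hK r s) (by positivity)
  have h3 : ∑ r, ∑ s, ‖hatS F r‖ * ‖hatS T r‖ * (‖hatS G s‖ * ‖hatS S s‖) *
        (2 * (p : ℝ) ^ ((3 : ℝ) / 4) + if r = 0 then (if s = 0 then (p : ℝ) else 0) else 0)
      = 2 * (p : ℝ) ^ ((3 : ℝ) / 4) * ((∑ r, ‖hatS F r‖ * ‖hatS T r‖) *
        (∑ s, ‖hatS G s‖ * ‖hatS S s‖)) + p * (F.card * T.card * (G.card * S.card)) := by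
    simp_rw [mul_add, Finset.sum_add_distrib]
    congr 1
    · rw [Finset.sum_mul_sum, Finset.mul_sum]
      refine Finset.sum_congr rfl fun r _ => ?_
      rw [Finset.mul_sum]
      refine Finset.sum_congr rfl fun s _ => ?_
      ring
    · rw [Finset.sum_eq_single 0, Finset.sum_eq_single 0]
      · simp [hat_zero]; ring
      · intro s _ hs; simp [hs]
      · simp
      · intro s _ hs; simp [hs]
      · simp
  rw [h3] at h2
  have h4 := mul_le_mul (sum_hat_le F T) (sum_hat_le G S) (by positivity) (by positivity)
  have h5 : 2 * (p : ℝ) ^ ((3 : ℝ) / 4) * ((∑ r, ‖hatS F r‖ * ‖hatS T r‖) *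
        (∑ s, ‖hatS G s‖ * ‖hatS S s‖)) ≤ 2 * (p : ℝ) ^ ((3 : ℝ) / 4) *
        (p * Real.sqrt (F.card * T.card) * (p * Real.sqrt (G.card * S.card))) :=
    mul_le_mul_of_nonneg_left h4 (by positivity)
  have h6 : (0 : ℝ) < p ^ 2 := by positivity
  refine le_of_mul_le_mul_left (h2.trans ((add_le_add_left h5 _).trans (le_of_eq ?_))) h6
  field_simp
  ring

/-- Sample count. -/
def samp {p k : ℕ} (B : Finset (ZMod p)) (a : Fin k → ZMod p) (x : ZMod p) : ℕ :=
  ∑ i, if x - a i ∈ B then 1 else 0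

lemma rep_eq {p : ℕ} (A B : Finset (ZMod p)) (x : ZMod p) :
    rep A B x = ∑ a ∈ A, if x - a ∈ B then 1 else 0 := by
  unfold rep
  refine Finset.sum_congr rfl fun a _ => ?_
  have : ∀ b ∈ B, (if a + b = x then 1 else 0) = if b = x - a then 1 else 0 := by
    intro b _
    congr 1
    rw [eq_sub_iff_add_eq, add_comm]
  rw [Finset.sum_congr rfl this, Finset.sum_ite_eq']

lemma mgf {p k : ℕ} (A B : Finset (ZMod p)) (x : ZMod p) (l : ℝ) :
    ∑ a ∈ Fintype.piFinset (fun _ : Fin k => A), Real.exp (l * samp B a x)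
      = (A.card + (Real.exp l - 1) * rep A B x) ^ k := by
  have h1 : ∀ a : Fin k → ZMod p, Real.exp (l * samp B a x)
      = ∏ i, (1 + (Real.exp l - 1) * if x - a i ∈ B then 1 else 0) := by
    intro a
    unfold samp
    push_cast
    rw [Finset.mul_sum, Real.exp_sum]
    refine Finset.prod_congr rfl fun i _ => ?_
    split_ifs <;> simp
  simp_rw [h1]
  rw [← Finset.prod_univ_sum (fun _ : Fin k => A)
    (fun _ a => (1 + (Real.exp l - 1) * if x - a ∈ B then (1 : ℝ) else 0)),
    Finset.prod_const, Finset.card_univ, Fintype.card_fin, rep_eq]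
  congr 1
  push_cast
  rw [Finset.sum_add_distrib, Finset.mul_sum]
  simp

lemma chern_up {p k : ℕ} (A B : Finset (ZMod p)) (x : ZMod p) (δ : ℝ)
    (h : (rep A B x : ℝ) < δ * A.card) :
    (((Fintype.piFinset (fun _ : Fin k => A)).filter fun a => 3 * δ * k ≤ samp B a x).card : ℝ)
      ≤ Real.exp (-(δ * k)) * (A.card : ℝ) ^ k := by
  set P := (Fintype.piFinset (fun _ : Fin k => A)).filter fun a => 3 * δ * k ≤ samp B a x
  have h1 : (P.card : ℝ) * Real.exp (3 * δ * k) ≤ (A.card + (Real.exp 1 - 1) * rep A B x) ^ k := by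
    rw [← mgf, ← nsmul_eq_mul, ← Finset.sum_const]
    calc _ ≤ ∑ a ∈ P, Real.exp (1 * samp B a x) := by
          refine Finset.sum_le_sum fun a ha => Real.exp_le_exp.2 ?_
          rw [one_mul]; exact (Finset.mem_filter.1 ha).2
      _ ≤ _ := Finset.sum_le_sum_of_subset_of_nonneg (Finset.filter_subset _ _)
          (fun _ _ _ => by positivity)
  have he : Real.exp 1 - 1 ≤ 2 := by linarith [Real.exp_one_lt_d9]
  have he0 : 0 ≤ Real.exp 1 - 1 := by linarith [Real.add_one_le_exp (1 : ℝ)]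
  have h2 : (A.card + (Real.exp 1 - 1) * rep A B x : ℝ) ≤ A.card * Real.exp (2 * δ) := by
    have := Real.add_one_le_exp (2 * δ)
    have h3 : (Real.exp 1 - 1) * rep A B x ≤ 2 * rep A B x := by gcongr
    have h4 : (A.card : ℝ) * (2 * δ + 1) ≤ A.card * Real.exp (2 * δ) := by gcongr
    linarith
  have h3 : (A.card + (Real.exp 1 - 1) * rep A B x : ℝ) ^ k ≤ (A.card * Real.exp (2 * δ)) ^ k := by
    gcongr
  rw [mul_pow, ← Real.exp_nat_mul] at h3
  have h4 : Real.exp (k * (2 * δ)) = Real.exp (-(δ * k)) * Real.exp (3 * δ * k) := by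
    rw [← Real.exp_add]; congr 1; ring
  rw [h4] at h3
  refine le_of_mul_le_mul_right (h1.trans (h3.trans (le_of_eq ?_))) (Real.exp_pos (3 * δ * k))
  ring

lemma chern_lo {p k : ℕ} (A B : Finset (ZMod p)) (x : ZMod p) (δ : ℝ)
    (h : 8 * δ * A.card ≤ (rep A B x : ℝ)) :
    (((Fintype.piFinset (fun _ : Fin k => A)).filter fun a => samp B a x < 3 * δ * k).card : ℝ)
      ≤ Real.exp (-(δ * k)) * (A.card : ℝ) ^ k := by
  set P := (Fintype.piFinset (fun _ : Fin k => A)).filter fun a => samp B a x < 3 * δ * k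
  have h1 : (P.card : ℝ) * Real.exp (-(3 * δ * k))
      ≤ (A.card + (Real.exp (-1) - 1) * rep A B x) ^ k := by
    rw [← mgf, ← nsmul_eq_mul, ← Finset.sum_const]
    calc _ ≤ ∑ a ∈ P, Real.exp (-1 * samp B a x) := by
          refine Finset.sum_le_sum fun a ha => Real.exp_le_exp.2 ?_
          have := (Finset.mem_filter.1 ha).2
          linarith
      _ ≤ _ := Finset.sum_le_sum_of_subset_of_nonneg (Finset.filter_subset _ _)
          (fun _ _ _ => by positivity)
  have he : Real.exp (-1) - 1 ≤ -(1 / 2) := by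
    linarith [Real.exp_neg_one_lt_d9]
  have he0 : 0 ≤ Real.exp (-1) := by positivity
  have hle : (rep A B x : ℝ) ≤ A.card := by exact_mod_cast rep_le_left A B x
  have h0 : (0 : ℝ) ≤ A.card + (Real.exp (-1) - 1) * rep A B x := by
    have : (0 : ℝ) ≤ Real.exp (-1) * rep A B x := by positivity
    linarith
  have h2 : (A.card + (Real.exp (-1) - 1) * rep A B x : ℝ) ≤ A.card * Real.exp (-(4 * δ)) := by
    have := Real.add_one_le_exp (-(4 * δ))
    have h3 : (Real.exp (-1) - 1) * rep A B x ≤ -(1 / 2) * rep A B x := by gcongr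
    have h4 : (A.card : ℝ) * (-(4 * δ) + 1) ≤ A.card * Real.exp (-(4 * δ)) := by gcongr
    linarith
  have h3 : (A.card + (Real.exp (-1) - 1) * rep A B x : ℝ) ^ k
      ≤ (A.card * Real.exp (-(4 * δ))) ^ k := by
    gcongr
  rw [mul_pow, ← Real.exp_nat_mul] at h3
  have h4 : Real.exp (k * (-(4 * δ))) = Real.exp (-(δ * k)) * Real.exp (-(3 * δ * k)) := by
    rw [← Real.exp_add]; congr 1; ring
  rw [h4] at h3
  refine le_of_mul_le_mul_right (h1.trans (h3.trans (le_of_eq ?_))) (Real.exp_pos (-(3 * δ * k)))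
  ring

/-- The event that the sample `a` misjudges `x`. -/
def badEv {p k : ℕ} (A B : Finset (ZMod p)) (δ : ℝ) (a : Fin k → ZMod p) (x : ZMod p) : Prop :=
  ((rep A B x : ℝ) < δ * A.card ∧ 3 * δ * k ≤ samp B a x) ∨
    (8 * δ * A.card ≤ (rep A B x : ℝ) ∧ samp B a x < 3 * δ * k)

lemma bad_count {p k : ℕ} (A B : Finset (ZMod p)) (x : ZMod p) (δ : ℝ) (hδ : 0 ≤ δ) :
    (((Fintype.piFinset (fun _ : Fin k => A)).filter fun a => badEv A B δ a x).card : ℝ)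
      ≤ Real.exp (-(δ * k)) * (A.card : ℝ) ^ k := by
  by_cases h : (rep A B x : ℝ) < δ * A.card
  · refine le_trans ?_ (chern_up A B x δ h)
    have h' : ¬ (8 * δ * A.card ≤ (rep A B x : ℝ)) := by
      have : 0 ≤ δ * A.card := by positivity
      intro h2; linarith
    refine Nat.cast_le.2 (Finset.card_le_card fun a ha => ?_)
    simp only [Finset.mem_filter, badEv, h, h', true_and, false_and, or_false] at ha ⊢
    exact ha
  · by_cases h' : (8 * δ * A.card ≤ (rep A B x : ℝ))
    · refine le_trans ?_ (chern_lo A B x δ h')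
      refine Nat.cast_le.2 (Finset.card_le_card fun a ha => ?_)
      simp only [Finset.mem_filter, badEv, h, h', true_and, false_and, false_or] at ha ⊢
      exact ha
    · have : ((Fintype.piFinset (fun _ : Fin k => A)).filter fun a => badEv A B δ a x) = ∅ := by
        refine Finset.filter_eq_empty_iff.2 fun a _ => ?_
        simp [badEv, h, h']
      rw [this]; simp; positivity

lemma samp_shift {p k : ℕ} (B : Finset (ZMod p)) (a : Fin k → ZMod p) (t x : ZMod p) :
    samp B (fun i => a i + t) x = samp B a (x - t) := by
  unfold samp
  refine Finset.sum_congr rfl fun i _ => ?_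
  rw [sub_sub, add_comm t]

/-- Croot and Sisask type almost periodicity. -/
lemma exists_periods {p : ℕ} [Fact p.Prime] (A B : Finset (ZMod p)) (δ : ℝ) (hδ : 0 ≤ δ) (k : ℕ) :
    ∃ T : Finset (ZMod p), (A.card : ℝ) ^ k * p ≤ 2 * (p : ℝ) ^ k * T.card ∧
      ∀ t ∈ T, ∀ t' ∈ T,
        ((Finset.univ.filter fun x => (rep A B x : ℝ) < δ * A.card ∧
          8 * δ * A.card ≤ (rep A B (x - t + t') : ℝ)).card : ℝ)
          ≤ 4 * Real.exp (-(δ * k)) * p := by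
  have hp : (0 : ℝ) < p := by exact_mod_cast (Fact.out : p.Prime).pos
  set β := Real.exp (-(δ * k)) with hβ
  have hβ0 : 0 < β := Real.exp_pos _
  set Q := Fintype.piFinset (fun _ : Fin k => A) with hQ
  have hQc : (Q.card : ℝ) = (A.card : ℝ) ^ k := by
    rw [hQ, Fintype.card_piFinset]; simp
  set Γ := Q.filter fun a => ((Finset.univ.filter fun x => badEv A B δ a x).card : ℝ) ≤ 2 * β * p
    with hΓ
  have hΓc : (A.card : ℝ) ^ k ≤ 2 * Γ.card := by
    have h1 : ∑ a ∈ Q, ((Finset.univ.filter fun x => badEv A B δ a x).card : ℝ)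
        ≤ p * (β * (A.card : ℝ) ^ k) := by
      have : ∑ a ∈ Q, ((Finset.univ.filter fun x => badEv A B δ a x).card : ℝ)
          = ∑ x : ZMod p, ((Q.filter fun a => badEv A B δ a x).card : ℝ) := by
        simp_rw [Finset.card_filter]
        push_cast
        rw [Finset.sum_comm]
      rw [this]
      refine (Finset.sum_le_sum fun x _ => bad_count A B x δ hδ).trans (le_of_eq ?_)
      rw [Finset.sum_const, Finset.card_univ, ZMod.card, nsmul_eq_mul]
    have h2 : ((Q \ Γ).card : ℝ) * (2 * β * p) ≤ p * (β * (A.card : ℝ) ^ k) := by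
      refine le_trans ?_ h1
      rw [← nsmul_eq_mul, ← Finset.sum_const]
      calc _ ≤ ∑ a ∈ Q \ Γ, ((Finset.univ.filter fun x => badEv A B δ a x).card : ℝ) := by
            refine Finset.sum_le_sum fun a ha => ?_
            rw [Finset.mem_sdiff, hΓ, Finset.mem_filter] at ha
            by_contra h
            exact ha.2 ⟨ha.1, (not_le.1 h).le⟩
        _ ≤ _ := Finset.sum_le_sum_of_subset_of_nonneg Finset.sdiff_subset
            (fun _ _ _ => by positivity)
    have h3 : ((Q \ Γ).card : ℝ) + Γ.card = (A.card : ℝ) ^ k := by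
      rw [← hQc]
      exact_mod_cast Finset.card_sdiff_add_card_eq_card (Finset.filter_subset _ _)
    have h4 : 2 * ((Q \ Γ).card : ℝ) ≤ (A.card : ℝ) ^ k := by
      refine le_of_mul_le_mul_right ?_ (mul_pos hβ0 hp)
      linarith
    linarith
  have hpig : ∃ a : Fin k → ZMod p, (p : ℝ) * Γ.card ≤
      (p : ℝ) ^ k * (Finset.univ.filter fun t : ZMod p => (fun i => a i + t) ∈ Γ).card := by
    by_contra! H
    have h1 : ∑ a : Fin k → ZMod p,
        ((Finset.univ.filter fun t : ZMod p => (fun i => a i + t) ∈ Γ).card : ℝ)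
        = p * Γ.card := by
      simp_rw [Finset.card_filter]
      push_cast
      rw [Finset.sum_comm]
      have : ∀ t : ZMod p, ∑ a : Fin k → ZMod p, (if (fun i => a i + t) ∈ Γ then (1 : ℝ) else 0)
          = Γ.card := by
        intro t
        refine (Fintype.sum_equiv (Equiv.addRight (fun _ : Fin k => t)) _
          (fun a => if a ∈ Γ then (1 : ℝ) else 0) (fun a => rfl)).trans ?_
        simp
      simp_rw [this]
      simp [ZMod.card]
    have h2 : ∑ a : Fin k → ZMod p, (p : ℝ) ^ k *
        ((Finset.univ.filter fun t : ZMod p => (fun i => a i + t) ∈ Γ).card : ℝ)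
        < ∑ a : Fin k → ZMod p, (p : ℝ) * Γ.card :=
      Finset.sum_lt_sum_of_nonempty Finset.univ_nonempty (fun a _ => H a)
    rw [← Finset.mul_sum, h1, Finset.sum_const, Finset.card_univ, nsmul_eq_mul] at h2
    simp [ZMod.card] at h2
  obtain ⟨a, ha⟩ := hpig
  refine ⟨Finset.univ.filter fun t : ZMod p => (fun i => a i + t) ∈ Γ, ?_, ?_⟩
  · nlinarith
  · intro t ht t' ht'
    simp only [Finset.mem_filter, Finset.mem_univ, true_and, hΓ] at ht ht'
    have hb := ht.2
    have hb' := ht'.2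
    have hsub : (Finset.univ.filter fun x => (rep A B x : ℝ) < δ * A.card ∧
          8 * δ * A.card ≤ (rep A B (x - t + t') : ℝ)) ⊆
        (Finset.univ.filter fun x => badEv A B δ (fun i => a i + t) x) ∪
        (Finset.univ.filter fun x => badEv A B δ (fun i => a i + t') x).image
          (fun y => y - t' + t) := by
      intro x hx
      simp only [Finset.mem_filter, Finset.mem_univ, true_and, Finset.mem_union,
        Finset.mem_image] at hx ⊢
      by_cases hS : 3 * δ * k ≤ samp B a (x - t)
      · left; left
        refine ⟨hx.1, ?_⟩
        rw [samp_shift]; exact hS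
      · right
        refine ⟨x - t + t', Or.inr ⟨hx.2, ?_⟩, by ring⟩
        rw [samp_shift, add_sub_cancel_right]
        exact not_le.1 hS
    have hc := (Finset.card_le_card hsub).trans ((Finset.card_union_le _ _).trans
      (Nat.add_le_add_left Finset.card_image_le _))
    have hc' : ((Finset.univ.filter fun x => (rep A B x : ℝ) < δ * A.card ∧
          8 * δ * A.card ≤ (rep A B (x - t + t') : ℝ)).card : ℝ) ≤
        ((Finset.univ.filter fun x => badEv A B δ (fun i => a i + t) x).card : ℝ) +
        ((Finset.univ.filter fun x => badEv A B δ (fun i => a i + t') x).card : ℝ) := by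
      exact_mod_cast hc
    linarith

/-- The negated set. -/
def ngS {p : ℕ} (T : Finset (ZMod p)) : Finset (ZMod p) := T.image (fun t => -t)

lemma ngS_ngS {p : ℕ} (T : Finset (ZMod p)) : ngS (ngS T) = T := by
  unfold ngS
  rw [Finset.image_image]
  ext x; simp

lemma card_ngS {p : ℕ} (T : Finset (ZMod p)) : (ngS T).card = T.card :=
  Finset.card_image_of_injective _ neg_injective

/-- The set of points where the smoothing of `A` by `T` is at least `η`. -/
def lev {p : ℕ} [NeZero p] (A T : Finset (ZMod p)) (η : ℝ) : Finset (ZMod p) :=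
  Finset.univ.filter fun y => η * T.card ≤ (rep A T y : ℝ)

lemma sum_rep_ng {p : ℕ} (A F T : Finset (ZMod p)) :
    ∑ a ∈ A, rep F (ngS T) a = ∑ y ∈ F, rep A T y := by
  unfold rep
  rw [Finset.sum_comm]
  refine Finset.sum_congr rfl fun y _ => Finset.sum_congr rfl fun a _ => ?_
  rw [ngS, Finset.sum_image (by intro a _ b _ h; simpa using h)]
  refine Finset.sum_congr rfl fun t _ => ?_
  congr 1
  apply propext
  constructor
  · intro h; rw [← h]; ring
  · intro h; rw [← h]; ring

lemma half {p : ℕ} [Fact p.Prime] (A T : Finset (ZMod p)) (η : ℝ) (hη : 0 ≤ η) :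
    (A.card : ℝ) * T.card - η * T.card * p ≤ ∑ a ∈ A, (rep (lev A T η) (ngS T) a : ℝ) := by
  have h1 : ∑ a ∈ A, (rep (lev A T η) (ngS T) a : ℝ) = ∑ y ∈ lev A T η, (rep A T y : ℝ) := by
    exact_mod_cast sum_rep_ng A (lev A T η) T
  have h2 : ∑ y, (rep A T y : ℝ) = A.card * T.card := by exact_mod_cast sum_rep A T
  have h3 := Finset.sum_add_sum_compl (lev A T η) (fun y => (rep A T y : ℝ))
  have h4 : ∑ y ∈ (lev A T η)ᶜ, (rep A T y : ℝ) ≤ η * T.card * p := by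
    calc _ ≤ ∑ y ∈ (lev A T η)ᶜ, (η * T.card : ℝ) := by
          refine Finset.sum_le_sum fun y hy => ?_
          simp only [lev, Finset.mem_compl, Finset.mem_filter, Finset.mem_univ, true_and,
            not_le] at hy
          exact hy.le
      _ ≤ ∑ y : ZMod p, (η * T.card : ℝ) := Finset.sum_le_sum_of_subset_of_nonneg
            (Finset.subset_univ _) (fun _ _ _ => by positivity)
      _ = _ := by
          rw [Finset.sum_const, Finset.card_univ, ZMod.card, nsmul_eq_mul]; ring
  rw [h1]
  linarith

lemma lower_FG {p : ℕ} [Fact p.Prime] (A T : Finset (ZMod p)) (h0 : (0 : ZMod p) ∉ A)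
    (hT : T.Nonempty) (η : ℝ) (hη : 0 ≤ η) :
    (T.card : ℝ) * (A.card - 2 * η * p) ≤ T.card * ((lev A T η).card *
      (lev (inv' A) (ngS T) η).card) / p + 2 * (p : ℝ) ^ ((3 : ℝ) / 4) * p := by
  have hp : (0 : ℝ) < p := by exact_mod_cast (Fact.out : p.Prime).pos
  have hTpos : (0 : ℝ) < T.card := by exact_mod_cast Finset.card_pos.2 hT
  set F := lev A T η with hF
  set G := lev (inv' A) (ngS T) η with hG
  have hinj : Function.Injective (fun x : ZMod p => x⁻¹) := inv_injective
  have hBc : (inv' A).card = A.card := Finset.card_image_of_injective _ hinj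
  have hu := half A T η hη
  have hv := half (inv' A) (ngS T) η hη
  rw [← hF] at hu
  rw [← hG, ngS_ngS, card_ngS, hBc, inv', Finset.sum_image (fun a _ b _ h => hinj h)] at hv
  have h1 : ∀ a ∈ A, (T.card : ℝ) * (rep F (ngS T) a + rep G T a⁻¹ - T.card)
      ≤ (rep F (ngS T) a : ℝ) * rep G T a⁻¹ := by
    intro a _
    have h2 : (rep F (ngS T) a : ℝ) ≤ T.card := by
      rw [← card_ngS T]; exact_mod_cast rep_le_right _ _ _
    have h3 : (rep G T a⁻¹ : ℝ) ≤ T.card := by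
      exact_mod_cast rep_le_right _ _ _
    nlinarith
  have h2 := Finset.sum_le_sum h1
  rw [← Finset.mul_sum, Finset.sum_sub_distrib, Finset.sum_add_distrib, Finset.sum_const,
    nsmul_eq_mul] at h2
  have h3 : ∑ a ∈ A, (rep F (ngS T) a : ℝ) * rep G T a⁻¹ ≤
      ∑ x : (ZMod p)ˣ, (rep F (ngS T) (x : ZMod p) : ℝ) * rep G T ((x⁻¹ : (ZMod p)ˣ) : ZMod p) := by
    simp_rw [Units.val_inv_eq_inv_val]
    rw [← Finset.sum_image (f := fun a : ZMod p => (rep F (ngS T) a : ℝ) * rep G T a⁻¹)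
      (s := Finset.univ) (g := fun x : (ZMod p)ˣ => (x : ZMod p)) (Units.val_injective.injOn)]
    refine Finset.sum_le_sum_of_subset_of_nonneg (fun a ha => ?_) (fun _ _ _ => by positivity)
    have hne : a ≠ 0 := fun h => h0 (h ▸ ha)
    exact Finset.mem_image.2 ⟨Units.mk0 a hne, Finset.mem_univ _, rfl⟩
  have h4 := incidence F (ngS T) G T
  rw [card_ngS] at h4
  have hcard : ∀ X : Finset (ZMod p), (X.card : ℝ) ≤ p := by
    intro X
    have := Finset.card_le_univ X
    rw [ZMod.card] at this
    exact_mod_cast this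
  have hs : ∀ X : Finset (ZMod p), Real.sqrt ((X.card : ℝ) * T.card) ≤ Real.sqrt (p * T.card) := by
    intro X
    apply Real.sqrt_le_sqrt
    exact mul_le_mul_of_nonneg_right (hcard X) hTpos.le
  have h5 : Real.sqrt ((F.card : ℝ) * T.card) * Real.sqrt (G.card * T.card) ≤ p * T.card := by
    refine (mul_le_mul (hs F) (hs G) (by positivity) (by positivity)).trans (le_of_eq ?_)
    exact Real.mul_self_sqrt (by positivity)
  have h6 : 2 * (p : ℝ) ^ ((3 : ℝ) / 4) * (Real.sqrt ((F.card : ℝ) * T.card) *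
      Real.sqrt (G.card * T.card)) ≤ 2 * (p : ℝ) ^ ((3 : ℝ) / 4) * (p * T.card) := by gcongr
  have h7 : (T.card : ℝ) * (A.card * T.card - η * T.card * p + (A.card * T.card - η * T.card * p)
      - A.card * T.card) ≤ T.card * (∑ a ∈ A, (rep F (ngS T) a : ℝ) + ∑ a ∈ A, (rep G T a⁻¹ : ℝ)
        - A.card * T.card) := by gcongr
  refine le_of_mul_le_mul_left ?_ hTpos
  calc _ = (T.card : ℝ) * (A.card * T.card - η * T.card * p + (A.card * T.card - η * T.card * p)
      - A.card * T.card) := by ring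
    _ ≤ (F.card : ℝ) * T.card * (G.card * T.card) / p
        + 2 * (p : ℝ) ^ ((3 : ℝ) / 4) * (p * T.card) := by linarith
    _ = _ := by ring

lemma conv_identity {p : ℕ} [Fact p.Prime] (A B T : Finset (ZMod p)) (x : ZMod p) :
    ∑ y, rep A T y * rep B (ngS T) (x - y) = ∑ t ∈ T, ∑ t' ∈ T, rep A B (x - t + t') := by
  have h1 : ∀ y, rep A T y = ∑ t ∈ T, if y - t ∈ A then 1 else 0 := by
    intro y; rw [rep_comm, rep_eq]
  have h2 : ∀ y, rep B (ngS T) y = ∑ t ∈ T, if y + t ∈ B then 1 else 0 := by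
    intro y
    rw [rep_comm, rep_eq, ngS, Finset.sum_image (by intro a _ b _ h; simpa using h)]
    simp
  simp_rw [h1, h2, Finset.sum_mul_sum]
  rw [Finset.sum_comm]
  refine Finset.sum_congr rfl fun t _ => ?_
  rw [Finset.sum_comm]
  refine Finset.sum_congr rfl fun t' _ => ?_
  rw [rep_eq]
  refine (Fintype.sum_equiv (Equiv.subRight t) _
    (fun a => if a ∈ A then (if x - t + t' - a ∈ B then 1 else 0) else 0) (fun y => ?_)).trans ?_
  · simp only [Equiv.subRight_apply, ite_mul, one_mul, zero_mul]
    rw [show x - t + t' - (y - t) = x - y + t' by ring]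
  · simp

lemma conv_lower {p : ℕ} [Fact p.Prime] (A B T : Finset (ZMod p)) (η : ℝ) (hη : 0 ≤ η)
    (x : ZMod p) :
    (η * T.card) ^ 2 * rep (lev A T η) (lev B (ngS T) η) x
      ≤ ∑ t ∈ T, ∑ t' ∈ T, (rep A B (x - t + t') : ℝ) := by
  have h : ∑ t ∈ T, ∑ t' ∈ T, (rep A B (x - t + t') : ℝ)
      = ∑ y, (rep A T y : ℝ) * rep B (ngS T) (x - y) := by
    exact_mod_cast (conv_identity A B T x).symm
  rw [h, rep_eq]
  push_cast
  rw [Finset.mul_sum]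
  refine le_trans (Finset.sum_le_sum fun y hy => ?_)
    (Finset.sum_le_sum_of_subset_of_nonneg (Finset.subset_univ (lev A T η))
      (fun _ _ _ => by positivity))
  split_ifs with h2
  · simp only [lev, Finset.mem_filter, Finset.mem_univ, true_and, card_ngS] at hy h2
    rw [mul_one, sq]
    exact mul_le_mul hy h2 (by positivity) (by positivity)
  · rw [mul_zero]; positivity

lemma exceptional {p : ℕ} [Fact p.Prime] (A B T : Finset (ZMod p)) (hA : A.Nonempty)
    (hT : T.Nonempty) (η δ κ M : ℝ)
    (hη : 0 ≤ η) (hδ : 0 ≤ δ) (hκ : 9 * δ * A.card ≤ η ^ 2 * (κ * p))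
    (hM : ∀ t ∈ T, ∀ t' ∈ T,
        ((Finset.univ.filter fun x => (rep A B x : ℝ) < δ * A.card ∧
          8 * δ * A.card ≤ (rep A B (x - t + t') : ℝ)).card : ℝ) ≤ M) :
    ((Finset.univ.filter fun x => (rep A B x : ℝ) < δ * A.card ∧
      κ * p ≤ (rep (lev A T η) (lev B (ngS T) η) x : ℝ)).card : ℝ) * δ ≤ M := by
  have hTpos : (0 : ℝ) < T.card := by exact_mod_cast Finset.card_pos.2 hT
  have hApos : (0 : ℝ) < A.card := by exact_mod_cast Finset.card_pos.2 hA
  set E := Finset.univ.filter fun x => (rep A B x : ℝ) < δ * A.card ∧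
      κ * p ≤ (rep (lev A T η) (lev B (ngS T) η) x : ℝ) with hE
  have h1 : ∀ x ∈ E, δ * (T.card : ℝ) ^ 2 ≤ ∑ t ∈ T, ∑ t' ∈ T,
      (if 8 * δ * A.card ≤ (rep A B (x - t + t') : ℝ) then (1 : ℝ) else 0) := by
    intro x hx
    simp only [hE, Finset.mem_filter, Finset.mem_univ, true_and] at hx
    have h2 := conv_lower A B T η hη x
    have h3 : ∑ t ∈ T, ∑ t' ∈ T, (rep A B (x - t + t') : ℝ) ≤
        ∑ t ∈ T, ∑ t' ∈ T, (8 * δ * A.card + A.card *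
          (if 8 * δ * A.card ≤ (rep A B (x - t + t') : ℝ) then (1 : ℝ) else 0)) := by
      refine Finset.sum_le_sum fun t _ => Finset.sum_le_sum fun t' _ => ?_
      have hle : (rep A B (x - t + t') : ℝ) ≤ A.card := by exact_mod_cast rep_le_left A B _
      have : 0 ≤ 8 * δ * A.card := by positivity
      split_ifs with h <;> linarith
    simp_rw [Finset.sum_add_distrib, ← Finset.mul_sum, Finset.sum_const, nsmul_eq_mul] at h3
    set W := ∑ t ∈ T, ∑ t' ∈ T,
      (if 8 * δ * A.card ≤ (rep A B (x - t + t') : ℝ) then (1 : ℝ) else 0)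
    have h4 : (η * T.card) ^ 2 * (κ * p) ≤ (η * T.card) ^ 2 *
        rep (lev A T η) (lev B (ngS T) η) x := by
      gcongr; exact hx.2
    have h5 : (T.card : ℝ) ^ 2 * (9 * δ * A.card) ≤ (T.card : ℝ) ^ 2 * (η ^ 2 * (κ * p)) := by
      gcongr
    refine le_of_mul_le_mul_left ?_ hApos
    linarith
  have h2 := Finset.sum_le_sum h1
  rw [Finset.sum_const, nsmul_eq_mul, Finset.sum_comm] at h2
  have h3 : ∑ t ∈ T, ∑ x ∈ E, ∑ t' ∈ T,
      (if 8 * δ * A.card ≤ (rep A B (x - t + t') : ℝ) then (1 : ℝ) else 0)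
      ≤ ∑ t ∈ T, ∑ t' ∈ T, M := by
    refine Finset.sum_le_sum fun t ht => ?_
    rw [Finset.sum_comm]
    refine Finset.sum_le_sum fun t' ht' => le_trans ?_ (hM t ht t' ht')
    rw [← Finset.sum_filter, Finset.sum_const, nsmul_eq_mul, mul_one]
    refine Nat.cast_le.2 (Finset.card_le_card fun x hx => ?_)
    simp only [hE, Finset.mem_filter, Finset.mem_univ, true_and] at hx ⊢
    exact ⟨hx.1.1, hx.2⟩
  simp only [Finset.sum_const, nsmul_eq_mul] at h3
  have h6 : (0 : ℝ) < (T.card : ℝ) ^ 2 := by positivity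
  refine le_of_mul_le_mul_left ?_ h6
  linarith

lemma pop_pollard {p : ℕ} [Fact p.Prime] (F G : Finset (ZMod p)) (t : ℕ) (hF : t ≤ F.card)
    (hG : t ≤ G.card) (κ : ℝ) (hκ : 0 ≤ κ) :
    (t : ℝ) * min (p : ℝ) (F.card + G.card - t) ≤
      t * (Finset.univ.filter fun x => κ * p ≤ (rep F G x : ℝ)).card + κ * p * p := by
  have h := pollard F G t hF hG
  have h' : (t : ℝ) * min (p : ℝ) (F.card + G.card - t) ≤ ∑ x, (min t (rep F G x) : ℕ) := by
    have : (t : ℝ) * ((min p (F.card + G.card - t) : ℕ) : ℝ) ≤ ((∑ x, min t (rep F G x) : ℕ) : ℝ) := by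
      exact_mod_cast h
    rw [Nat.cast_min, Nat.cast_sub (by omega)] at this
    push_cast at this ⊢
    exact this
  refine h'.trans ?_
  push_cast
  have : ∀ x, (min (t : ℝ) (rep F G x)) ≤ t * (if κ * p ≤ (rep F G x : ℝ) then 1 else 0) + κ * p := by
    intro x
    have h0 : 0 ≤ κ * p := by positivity
    split_ifs with h1
    · have := min_le_left (t : ℝ) (rep F G x); linarith
    · have := min_le_right (t : ℝ) (rep F G x); linarith
  refine (Finset.sum_le_sum fun x _ => this x).trans ?_
  rw [Finset.sum_add_distrib, ← Finset.mul_sum, ← Finset.sum_filter]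
  simp only [Finset.sum_const, nsmul_eq_mul, mul_one, Finset.card_univ, ZMod.card]
  apply le_of_eq; ring

lemma pop_small {p : ℕ} [Fact p.Prime] (F G : Finset (ZMod p)) (κ : ℝ) (hκ : 0 ≤ κ) :
    (F.card : ℝ) * G.card ≤
      F.card * (Finset.univ.filter fun x => κ * p ≤ (rep F G x : ℝ)).card + κ * p * p := by
  have h : (F.card : ℝ) * G.card = ∑ x, (rep F G x : ℝ) := by exact_mod_cast (sum_rep F G).symm
  rw [h]
  have : ∀ x, (rep F G x : ℝ) ≤ F.card * (if κ * p ≤ (rep F G x : ℝ) then 1 else 0) + κ * p := by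
    intro x
    have h0 : 0 ≤ κ * p := by positivity
    have : (rep F G x : ℝ) ≤ F.card := by exact_mod_cast rep_le_left F G x
    split_ifs with h1 <;> linarith
  refine (Finset.sum_le_sum fun x _ => this x).trans ?_
  rw [Finset.sum_add_distrib, ← Finset.mul_sum, ← Finset.sum_filter]
  simp only [Finset.sum_const, nsmul_eq_mul, mul_one, Finset.card_univ, ZMod.card]
  apply le_of_eq; ring

lemma pop_case {p : ℕ} [Fact p.Prime] (F G : Finset (ZMod p)) (q d : ℝ) (hd : 0 < d)
    (hdq : 20 * d ≤ q)
    (hFG : (p : ℝ) ^ 2 * (q ^ 2 - 9 * q * d) ≤ F.card * G.card)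
    (hF : (F.card : ℝ) ≤ 2 * d * p) :
    2 * q * p ≤ (Finset.univ.filter fun x => d ^ 2 * p ≤ (rep F G x : ℝ)).card := by
  have hp : (0 : ℝ) < p := by exact_mod_cast (Fact.out : p.Prime).pos
  have hq : 0 < q := by linarith
  have h := pop_small F G (d ^ 2) (by positivity)
  generalize ((Finset.univ.filter fun x => d ^ 2 * p ≤ (rep F G x : ℝ)).card : ℝ) = S at *
  have h1 : (p : ℝ) ^ 2 * (q ^ 2 / 2) ≤ F.card * G.card := by
    refine le_trans ?_ hFG
    gcongr
    nlinarith
  have hFG0 : (0 : ℝ) < F.card * G.card := lt_of_lt_of_le (by positivity) h1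
  have hF0 : (0 : ℝ) < F.card := by
    rcases (Nat.cast_nonneg F.card : (0 : ℝ) ≤ F.card).eq_or_lt with h0 | h0
    · rw [← h0] at hFG0; simp at hFG0
    · exact h0
  have hG5 : 5 * q * p ≤ G.card := by
    have h2 : (F.card : ℝ) * G.card ≤ q * p / 10 * G.card := by
      gcongr
      nlinarith
    have h3 : q * p / 10 * (5 * q * p) ≤ q * p / 10 * G.card := by
      refine le_trans (le_of_eq ?_) (h1.trans h2); ring
    exact le_of_mul_le_mul_left h3 (by positivity)
  have h4 : d ^ 2 * p * p ≤ (F.card * G.card) / 2 := by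
    have : d ^ 2 ≤ q ^ 2 / 4 := by nlinarith
    have h5 : (p : ℝ) ^ 2 * d ^ 2 ≤ p ^ 2 * (q ^ 2 / 4) := by gcongr
    nlinarith
  have h6 : (F.card : ℝ) * (G.card / 2) ≤ F.card * S := by linarith
  have h7 := le_of_mul_le_mul_left h6 hF0
  have : 0 < q * p := by positivity
  linarith

lemma pop_lower {p : ℕ} [Fact p.Prime] (F G : Finset (ZMod p)) (q d : ℝ) (hd : 0 < d)
    (hdq : 20 * d ≤ q) (hdp : 1 ≤ d * p)
    (hFG : (p : ℝ) ^ 2 * (q ^ 2 - 9 * q * d) ≤ F.card * G.card) :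
    min (2 * q * p) p - 21 * d * p ≤
      (Finset.univ.filter fun x => d ^ 2 * p ≤ (rep F G x : ℝ)).card := by
  have hp : (0 : ℝ) < p := by exact_mod_cast (Fact.out : p.Prime).pos
  have hq : 0 < q := by linarith
  set t := ⌈d * p⌉₊ with ht
  have ht1 : d * p ≤ t := Nat.le_ceil _
  have ht2 : (t : ℝ) ≤ 2 * d * p := by
    have := (Nat.ceil_lt_add_one (show 0 ≤ d * p by linarith)).le
    linarith
  have ht0 : (0 : ℝ) < t := by linarith
  by_cases hF : t ≤ F.card
  · by_cases hG : t ≤ G.card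
    · have h := pop_pollard F G t hF hG (d ^ 2) (by positivity)
      generalize ((Finset.univ.filter fun x => d ^ 2 * p ≤ (rep F G x : ℝ)).card : ℝ) = S at *
      have h1 : d ^ 2 * p * p ≤ t * (d * p) := by
        have : (d * p) * (d * p) ≤ t * (d * p) := by gcongr
        linarith
      have h2 : (t : ℝ) * min (p : ℝ) (F.card + G.card - t) ≤ t * (S + d * p) := by linarith
      have h3 := le_of_mul_le_mul_left h2 ht0
      have h4 : 2 * p * (q - 9 * d) ≤ (F.card : ℝ) + G.card := by
        refine abs_le_of_sq_le_sq' ?_ (by positivity) |>.2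
        have h5 : (q - 9 * d) ^ 2 ≤ q ^ 2 - 9 * q * d := by nlinarith
        have h6 : (p : ℝ) ^ 2 * (q - 9 * d) ^ 2 ≤ (p : ℝ) ^ 2 * (q ^ 2 - 9 * q * d) := by gcongr
        nlinarith [sq_nonneg ((F.card : ℝ) - G.card)]
      have h7 : min (2 * q * p) p - 20 * d * p ≤ min (p : ℝ) (F.card + G.card - t) := by
        refine le_min ?_ ?_
        · have := min_le_right (2 * q * p) (p : ℝ)
          nlinarith
        · have := min_le_left (2 * q * p) (p : ℝ)
          nlinarith
      linarith
    · have hG' : (G.card : ℝ) ≤ 2 * d * p := by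
        have : (G.card : ℝ) ≤ t := by exact_mod_cast (not_le.1 hG).le
        linarith
      have h := pop_case G F q d hd hdq (by rw [mul_comm (G.card : ℝ)]; exact hFG) hG'
      simp_rw [rep_comm G F] at h
      have := min_le_left (2 * q * p) (p : ℝ)
      nlinarith
  · have hF' : (F.card : ℝ) ≤ 2 * d * p := by
      have : (F.card : ℝ) ≤ t := by exact_mod_cast (not_le.1 hF).le
      linarith
    have h := pop_case F G q d hd hdq hFG hF'
    have := min_le_left (2 * q * p) (p : ℝ)
    nlinarith

lemma core {p : ℕ} [Fact p.Prime] (A : Finset (ZMod p)) (h0 : (0 : ZMod p) ∉ A) (q d : ℝ) (k : ℕ)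
    (hA : (A.card : ℝ) = q ^ 2 * p) (hd : 0 < d) (hdq : 20 * d ≤ q) (hq1 : q ≤ 1)
    (hdp : 1 ≤ d * p) (hk : Real.exp (-(d ^ 4 * k)) ≤ d ^ 8)
    (hpk : (p : ℝ) ^ ((3 : ℝ) / 4) ≤ p * d ^ (2 * k + 2)) :
    min (2 * q * p) p - 22 * d * p ≤ (psum A (inv' A) (q ^ 2 * d ^ 4)).card := by
  have hp : (0 : ℝ) < p := by exact_mod_cast (Fact.out : p.Prime).pos
  have hq : 0 < q := by linarith
  have hAne : A.Nonempty := by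
    rw [← Finset.card_pos, ← Nat.cast_pos (α := ℝ), hA]; positivity
  obtain ⟨T, hTc, hTM⟩ := exists_periods A (inv' A) (d ^ 4) (by positivity) k
  have hTc' : p * d ^ (2 * k) ≤ 2 * T.card := by
    rw [hA, mul_pow] at hTc
    have h1 : (d ^ 2) ^ k ≤ (q ^ 2) ^ k := by
      gcongr; linarith
    have h2 : (p : ℝ) ^ k * ((q ^ 2) ^ k * p) ≤ p ^ k * (2 * T.card) := by
      refine le_trans (le_of_eq ?_) (hTc.trans (le_of_eq ?_)) <;> ring
    have h3 := le_of_mul_le_mul_left h2 (by positivity)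
    rw [pow_mul]
    have h4 : (p : ℝ) * (d ^ 2) ^ k ≤ p * (q ^ 2) ^ k := by gcongr
    linarith
  have hTpos : (0 : ℝ) < T.card := by
    have : 0 < p * d ^ (2 * k) := by positivity
    linarith
  have hTne : T.Nonempty := by
    rw [← Finset.card_pos, ← Nat.cast_pos (α := ℝ)]; exact hTpos
  set η := 3 * q * d with hη
  have hη0 : 0 ≤ η := by positivity
  set F := lev A T η with hF
  set G := lev (inv' A) (ngS T) η with hG
  have hFG : (p : ℝ) ^ 2 * (q ^ 2 - 9 * q * d) ≤ F.card * G.card := by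
    have h1 := lower_FG A T h0 hTne η hη0
    rw [← hF, ← hG] at h1
    have h2 : 2 * (p : ℝ) ^ ((3 : ℝ) / 4) ≤ T.card * η := by
      have h3 : 4 * d ^ 2 ≤ η := by rw [hη]; nlinarith
      have h4 : (p * d ^ (2 * k) / 2) * (4 * d ^ 2) ≤ T.card * η :=
        mul_le_mul (by linarith) h3 (by positivity) (by positivity)
      have h5 : (p * d ^ (2 * k) / 2) * (4 * d ^ 2) = 2 * (p * d ^ (2 * k + 2)) := by ring
      linarith
    have h6 : 2 * (p : ℝ) ^ ((3 : ℝ) / 4) * p ≤ T.card * η * p := by gcongr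
    have h7 : (T.card : ℝ) * (A.card - 2 * η * p) ≤ T.card * (F.card * G.card / p + η * p) := by
      refine h1.trans (le_of_le_of_eq (add_le_add_right h6 _) ?_)
      ring
    have h8 := le_of_mul_le_mul_left h7 hTpos
    rw [hA] at h8
    have h9 : p * (q ^ 2 - 9 * q * d) ≤ (F.card * G.card : ℝ) / p := by
      rw [hη] at h8; linarith
    rw [le_div_iff₀ hp] at h9
    linarith
  have hS := pop_lower F G q d hd hdq hdp hFG
  have hE := exceptional A (inv' A) T hAne hTne η (d ^ 4) (d ^ 2) _ hη0 (by positivity)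
    (le_of_eq (by rw [hA, hη]; ring)) hTM
  rw [← hF, ← hG] at hE
  have hrep : ∀ x, ((((A ×ˢ inv' A).filter fun ab => ab.1 + ab.2 = x).card : ℕ) : ℝ)
      = rep A (inv' A) x := by
    intro x
    rw [Finset.card_filter, Finset.sum_product, rep]
  have hsub : (Finset.univ.filter fun x => d ^ 2 * p ≤ (rep F G x : ℝ)) ⊆
      psum A (inv' A) (q ^ 2 * d ^ 4) ∪ (Finset.univ.filter fun x =>
        (rep A (inv' A) x : ℝ) < d ^ 4 * A.card ∧ d ^ 2 * p ≤ (rep F G x : ℝ)) := by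
    intro x hx
    simp only [psum, Finset.mem_union, Finset.mem_filter, Finset.mem_univ, true_and, hrep] at hx ⊢
    by_cases h : q ^ 2 * d ^ 4 * p ≤ (rep A (inv' A) x : ℝ)
    · left; exact h
    · right
      refine ⟨?_, hx⟩
      rw [hA]
      linarith [not_le.1 h]
  have hc := (Finset.card_le_card hsub).trans (Finset.card_union_le _ _)
  have hc' : ((Finset.univ.filter fun x => d ^ 2 * p ≤ (rep F G x : ℝ)).card : ℝ) ≤
      (psum A (inv' A) (q ^ 2 * d ^ 4)).card + (Finset.univ.filter fun x =>
        (rep A (inv' A) x : ℝ) < d ^ 4 * A.card ∧ d ^ 2 * p ≤ (rep F G x : ℝ)).card := by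
    exact_mod_cast hc
  have hE' : ((Finset.univ.filter fun x =>
        (rep A (inv' A) x : ℝ) < d ^ 4 * A.card ∧ d ^ 2 * p ≤ (rep F G x : ℝ)).card : ℝ)
      ≤ d * p := by
    have h1 : 4 * Real.exp (-(d ^ 4 * k)) * p ≤ 4 * d ^ 8 * p := by gcongr
    have h3 : 4 * d ^ 8 * p ≤ d * p * d ^ 4 := by
      have hd1 : d ≤ 1 / 20 := by linarith
      have : d ^ 3 ≤ (1 / 20) ^ 3 := by gcongr
      have h5 : 0 < d ^ 5 * p := by positivity
      nlinarith
    exact le_of_mul_le_mul_right (hE.trans (h1.trans h3)) (by positivity)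
  linarith

set_option maxHeartbeats 2000000 in
/-- Theorem on the size of the partial sumset `A +_ε A*` for dense `A ⊆ 𝔽_p^*`:
`|A +_ε A*| ≥ min(2√(|A|p), p) − C·(ε/α)^{1/4}·p`. -/
theorem card_partial_add_inv_lower_bound :
    ∃ C : ℝ, C > 0 ∧ ∃ c : ℝ, c > 0 ∧ ∃ p₀ : ℕ, ∀ (p : ℕ) [Fact p.Prime], p ≥ p₀ →
      ∀ A : Finset (ZMod p), (0 : ZMod p) ∉ A →
        ∀ α : ℝ, (A.card : ℝ) = α * p →
          α ≥ C * (Real.log (Real.log p)) ^ ((2 : ℝ) / 3) / (Real.log p) ^ ((1 : ℝ) / 3) →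
            ∀ ε : ℝ,
              C * α * (Real.log (Real.log p)) ^ ((4 : ℝ) / 3) / (Real.log p) ^ ((2 : ℝ) / 3) ≤ ε →
              ε ≤ c * α ^ 3 →
                (((psum A (inv' A) ε).card : ℝ) ≥
                  min (2 * Real.sqrt ((A.card : ℝ) * p)) (p : ℝ)
                    - C * (ε / α) ^ ((1 : ℝ) / 4) * p) := by
  refine ⟨22, by norm_num, (1 / 20) ^ 4, by norm_num, ⌈Real.exp (Real.exp 1)⌉₊, ?_⟩
  intro p _ hp₀ A h0 α hA hα ε hε1 hε2
  have hp : (0 : ℝ) < p := by exact_mod_cast (Fact.out : p.Prime).pos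
  have hpe : Real.exp (Real.exp 1) ≤ p := (Nat.le_ceil _).trans (by exact_mod_cast hp₀)
  set y := Real.log p with hy
  have hye : Real.exp 1 ≤ y := (Real.le_log_iff_exp_le hp).2 hpe
  have hy0 : 0 < y := lt_of_lt_of_le (Real.exp_pos _) hye
  have hy1 : 1 ≤ y := by linarith [Real.add_one_le_exp (1 : ℝ)]
  set L := Real.log y with hL
  have hL1 : 1 ≤ L := (Real.le_log_iff_exp_le hy0).2 hye
  have hL0 : 0 < L := by linarith
  have hα0 : 0 < α := lt_of_lt_of_le (by positivity) hα
  have hε0 : 0 < ε := lt_of_lt_of_le (by positivity) hε1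
  have hα1 : α ≤ 1 := by
    have h1 := Finset.card_le_univ A
    rw [ZMod.card] at h1
    have h2 : (A.card : ℝ) ≤ p := by exact_mod_cast h1
    rw [hA] at h2
    exact le_of_mul_le_mul_right (by linarith) hp
  set δ := ε / α with hδ
  have hδ0 : 0 < δ := by positivity
  have hεδ : ε = α * δ := by rw [hδ]; field_simp
  have hδα : δ ≤ (1 / 20) ^ 4 * α ^ 2 := by
    rw [hδ, div_le_iff₀ hα0]
    refine hε2.trans (le_of_eq ?_); ring
  have hδL : 22 * L ^ ((4 : ℝ) / 3) / y ^ ((2 : ℝ) / 3) ≤ δ := by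
    rw [hδ, le_div_iff₀ hα0]
    refine le_trans (le_of_eq ?_) hε1; ring
  have hy23 : 0 < y ^ ((2 : ℝ) / 3) := by positivity
  have hL43 : 1 ≤ L ^ ((4 : ℝ) / 3) := Real.one_le_rpow hL1 (by norm_num)
  have hδy : 1 / y ≤ δ := by
    refine le_trans ?_ hδL
    rw [div_le_div_iff₀ hy0 hy23]
    have : y ^ ((2 : ℝ) / 3) ≤ y ^ (1 : ℝ) := Real.rpow_le_rpow_of_exponent_le hy1 (by norm_num)
    rw [Real.rpow_one] at this
    nlinarith
  set ℓ := Real.log (1 / δ) with hℓ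
  have hℓL : ℓ ≤ L := by
    apply Real.log_le_log (by positivity)
    rw [div_le_iff₀ hδ0]
    rw [div_le_iff₀ hy0] at hδy
    linarith
  have hδs : δ ≤ (1 / 20) ^ 4 := by
    have : α ^ 2 ≤ 1 := by nlinarith
    nlinarith
  have hℓ1 : 1 ≤ ℓ := by
    rw [hℓ, Real.le_log_iff_exp_le (by positivity), le_div_iff₀ hδ0]
    have := Real.exp_one_lt_d9
    nlinarith
  have hkey : 8 * ℓ ^ 2 ≤ δ * y := by
    rw [div_le_iff₀ hy23] at hδL
    have h1 : L ≤ y ^ ((1 : ℝ) / 2) := by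
      have h2 := Real.log_le_rpow_div hy0.le (show (0 : ℝ) < 1 / 2 by norm_num)
      have h3 := Real.add_one_le_exp (L / 2 - 1)
      have h4 : y ^ ((1 : ℝ) / 2) = Real.exp (L / 2 - 1) * Real.exp 1 := by
        rw [← Real.exp_add, Real.rpow_def_of_pos hy0]
        congr 1; rw [← hL]; ring
      rw [h4]
      have h5 : 2 ≤ Real.exp 1 := by linarith [Real.add_one_le_exp (1 : ℝ)]
      nlinarith
    have h2 : L ^ ((2 : ℝ) / 3) ≤ y ^ ((1 : ℝ) / 3) := by
      have := Real.rpow_le_rpow hL0.le h1 (show (0 : ℝ) ≤ 2 / 3 by norm_num)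
      rw [← Real.rpow_mul hy0.le] at this
      norm_num at this
      exact this
    have h3 : L ^ 2 = L ^ ((4 : ℝ) / 3) * L ^ ((2 : ℝ) / 3) := by
      rw [← Real.rpow_add hL0, ← Real.rpow_natCast]; norm_num
    have h4 : y = y ^ ((2 : ℝ) / 3) * y ^ ((1 : ℝ) / 3) := by
      rw [← Real.rpow_add hy0]; norm_num
    have hy13 : 0 < y ^ ((1 : ℝ) / 3) := by positivity
    calc 8 * ℓ ^ 2 ≤ 22 * L ^ 2 := by nlinarith
      _ = 22 * L ^ ((4 : ℝ) / 3) * L ^ ((2 : ℝ) / 3) := by rw [h3]; ring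
      _ ≤ 22 * L ^ ((4 : ℝ) / 3) * y ^ ((1 : ℝ) / 3) := by gcongr
      _ ≤ δ * y ^ ((2 : ℝ) / 3) * y ^ ((1 : ℝ) / 3) := by gcongr
      _ = δ * y := by rw [mul_assoc, ← h4]
  set d := δ ^ ((1 : ℝ) / 4) with hd
  have hd0 : 0 < d := by positivity
  have hd4 : d ^ 4 = δ := by
    rw [hd, ← Real.rpow_natCast, ← Real.rpow_mul hδ0.le]; norm_num
  set q := Real.sqrt α with hq
  have hq0 : 0 < q := Real.sqrt_pos.2 hα0
  have hq2 : q ^ 2 = α := Real.sq_sqrt hα0.le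
  have hlogd : Real.log d = -(ℓ / 4) := by
    rw [hd, Real.log_rpow hδ0, hℓ, one_div δ, Real.log_inv]; ring
  have hdq : 20 * d ≤ q := by
    refine le_of_pow_le_pow_left₀ (n := 4) (by norm_num) hq0.le ?_
    rw [mul_pow, hd4, show q ^ 4 = (q ^ 2) ^ 2 by ring, hq2]
    nlinarith
  have hq1 : q ≤ 1 := by rw [hq]; exact Real.sqrt_le_one.2 hα1
  set k := ⌈2 * ℓ / δ⌉₊ with hk
  have hk1 : 2 * ℓ / δ ≤ k := Nat.le_ceil _
  have hk2 : (k : ℝ) ≤ 2 * ℓ / δ + 1 := (Nat.ceil_lt_add_one (by positivity)).le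
  have hdp : 1 ≤ d * p := by
    have h1 : δ ≤ d := by
      rw [← hd4]
      have : d ≤ 1 := by linarith
      exact pow_le_of_le_one hd0.le this (by norm_num)
    have h2 : y ≤ p := by
      have := Real.log_le_sub_one_of_pos hp
      linarith
    rw [div_le_iff₀ hy0] at hδy
    calc 1 ≤ δ * y := hδy
      _ ≤ d * p := by gcongr
  have hexp : Real.exp (-(d ^ 4 * k)) ≤ d ^ 8 := by
    have h1 : d ^ 8 = Real.exp (-(2 * ℓ)) := by
      rw [← Real.exp_log (show 0 < d ^ 8 by positivity), Real.log_pow, hlogd]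
      congr 1; push_cast; ring
    rw [h1, hd4]
    apply Real.exp_le_exp.2
    rw [div_le_iff₀ hδ0] at hk1
    linarith
  have hpk : (p : ℝ) ^ ((3 : ℝ) / 4) ≤ p * d ^ (2 * k + 2) := by
    rw [← Real.log_le_log_iff (by positivity) (by positivity), Real.log_rpow hp,
      Real.log_mul hp.ne' (by positivity), Real.log_pow, hlogd, ← hy]
    push_cast
    have h1 : (2 * k + 2 : ℝ) ≤ 8 * (ℓ / δ) := by
      have h2 : 1 ≤ ℓ / δ := by
        rw [le_div_iff₀ hδ0]; linarith
      have : 2 * ℓ / δ = 2 * (ℓ / δ) := by ring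
      linarith
    have h3 : (2 * k + 2 : ℝ) * (ℓ / 4) ≤ 8 * (ℓ / δ) * (ℓ / 4) := by gcongr
    have h4 : 8 * (ℓ / δ) * (ℓ / 4) ≤ y / 4 := by
      rw [show 8 * (ℓ / δ) * (ℓ / 4) = 2 * ℓ ^ 2 / δ by field_simp; ring, div_le_iff₀ hδ0]
      linarith
    linarith
  have hfin := core A h0 q d k (by rw [hq2]; exact hA) hd0 hdq hq1 hdp hexp hpk
  rw [hq2, hd4, ← hεδ] at hfin
  have hsq : Real.sqrt ((A.card : ℝ) * p) = q * p := by
    rw [hA, show α * p * p = (q * p) ^ 2 by rw [mul_pow, hq2]; ring]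
    exact Real.sqrt_sq (by positivity)
  rw [hsq, ← mul_assoc]
  exact hfin
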